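/- Let m be a natural number and let g : (Fin m → ℝ) → (Fin m → ℝ) → (Fin m → ℝ) be monotone in each argument with respect to the componentwise order. Let A and B be finite sets of QoS tuples. Then the set of non-dominated elements of { g a b : a ∈ A, b ∈ B } equals the set of non-dominated elements of { g a b : a ∈ Pareto(A), b ∈ Pareto(B) }, where Pareto(X) denotes the set of non-dominated elements of X. -/

import Mathlib

/-- `t'` dominates `t` (componentwise order on `Fin m → ℝ`). -/
def Dominates {m : ℕ} (t' t : Fin m → ℝ) : Prop := t ≤ t' ∧ t ≠ t'

/-- `t` is non-dominated (Pareto optimal) in `S`. -/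
def NonDominated {m : ℕ} (S : Set (Fin m → ℝ)) (t : Fin m → ℝ) : Prop :=
  t ∈ S ∧ ∀ t' ∈ S, ¬ Dominates t' t

/-- The Pareto front (set of non-dominated elements) of `S`. -/
def Pareto {m : ℕ} (S : Set (Fin m → ℝ)) : Set (Fin m → ℝ) :=
  {t | NonDominated S t}

theorem nonDominated_iff_maximal {m : ℕ} {S : Set (Fin m → ℝ)} {t : Fin m → ℝ} :
    NonDominated S t ↔ Maximal (· ∈ S) t := by
  refine and_congr_right fun _ => ⟨fun h t' ht' hle => ?_, fun h t' ht' hd => ?_⟩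
  · by_contra hn
    exact h t' ht' ⟨hle, fun he => hn he.ge⟩
  · exact hd.2 (le_antisymm hd.1 (h ht' hd.1))

theorem Set.Finite.exists_le_mem_pareto {m : ℕ} {S : Set (Fin m → ℝ)} (hS : S.Finite)
    {a : Fin m → ℝ} (ha : a ∈ S) : ∃ b ∈ Pareto S, a ≤ b := by
  obtain ⟨b, hab, hb⟩ := hS.exists_le_maximal ha
  exact ⟨b, nonDominated_iff_maximal.2 hb, hab⟩

/-- Passing to a cofinal subset does not change the Pareto front. -/
theorem pareto_eq_of_subset_of_cofinal {m : ℕ} {S T : Set (Fin m → ℝ)} (hTS : T ⊆ S)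
    (hST : ∀ s ∈ S, ∃ t ∈ T, s ≤ t) : Pareto S = Pareto T := by
  ext x
  change NonDominated S x ↔ NonDominated T x
  rw [nonDominated_iff_maximal, nonDominated_iff_maximal]
  constructor
  · intro h
    obtain ⟨t, ht, hxt⟩ := hST x h.prop
    obtain rfl : x = t := h.eq_of_le (hTS ht) hxt
    exact ⟨ht, fun y hy hxy => h.le_of_ge (hTS hy) hxy⟩
  · intro h
    refine ⟨hTS h.prop, fun y hy hxy => ?_⟩
    obtain ⟨t, ht, hyt⟩ := hST y hy
    exact hyt.trans (h.le_of_ge ht (hxy.trans hyt))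

theorem stmt_4 {m : ℕ} (g : (Fin m → ℝ) → (Fin m → ℝ) → (Fin m → ℝ))
    (hg1 : ∀ b, Monotone (fun a => g a b)) (hg2 : ∀ a, Monotone (g a))
    (A B : Finset (Fin m → ℝ)) :
    Pareto (Set.image2 g ↑A ↑B) = Pareto (Set.image2 g (Pareto ↑A) (Pareto ↑B)) := by
  refine pareto_eq_of_subset_of_cofinal
    (Set.image2_subset (fun _ h => h.1) (fun _ h => h.1)) ?_
  rintro _ ⟨a, ha, b, hb, rfl⟩
  obtain ⟨a', ha', haa'⟩ := A.finite_toSet.exists_le_mem_pareto ha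
  obtain ⟨b', hb', hbb'⟩ := B.finite_toSet.exists_le_mem_pareto hb
  exact ⟨g a' b', Set.mem_image2_of_mem ha' hb', (hg1 b haa').trans (hg2 a' hbb')⟩
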